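/- Let n ≥ 1, let b₁, b₂, b₃ ∈ ℤ/2, and set ṽ := v + b₁ + b₂·x^{2n}·w + b₃·x^{2n}·v·w in R. Then the ℤ/2-algebra homomorphism from (ℤ/2)[X,V,W]/(X^{2n+2}, V² + b₁ + (n+1)X^{2n}W) to R determined by X ↦ x, V ↦ ṽ, W ↦ w is well defined and is an isomorphism of ℤ/2-algebras. -/

import Mathlib

open MvPolynomial

noncomputable section

/-- The polynomial ring `(ℤ/2)[x,v,w]`. -/
abbrev P : Type := MvPolynomial (Fin 3) (ZMod 2)

/-- The ideal `(x^{2n+2}, v² + b₁ + (n+1)·x^{2n}·w)` (the coefficient `n+1` read mod 2). -/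
def relIdealB (n : ℕ) (b₁ : ZMod 2) : Ideal P :=
  Ideal.span {(X 0 : P) ^ (2 * n + 2),
    (X 1 : P) ^ 2 + C b₁ + C ((n : ZMod 2) + 1) * (X 0 : P) ^ (2 * n) * X 2}

/-- `R_{b₁} = (ℤ/2)[x,v,w]/(x^{2n+2}, v² + b₁ + (n+1)x^{2n}w)`; for `b₁ = 0` this is
Westerland's presentation of `ℍ_*(L ℝP^{2n+1}; ℤ/2)`. -/
abbrev Rb (n : ℕ) (b₁ : ZMod 2) : Type := P ⧸ relIdealB n b₁

/-- The quotient map as a `ℤ/2`-algebra homomorphism. -/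
def mkRb (n : ℕ) (b₁ : ZMod 2) : P →ₐ[ZMod 2] Rb n b₁ :=
  Ideal.Quotient.mkₐ (ZMod 2) (relIdealB n b₁)

def x (n : ℕ) (b₁ : ZMod 2) : Rb n b₁ := mkRb n b₁ (X 0)
def v (n : ℕ) (b₁ : ZMod 2) : Rb n b₁ := mkRb n b₁ (X 1)
def w (n : ℕ) (b₁ : ZMod 2) : Rb n b₁ := mkRb n b₁ (X 2)

lemma two_eq_zero_Rb (n : ℕ) (c : ZMod 2) : (2 : Rb n c) = 0 := by
  rw [← map_ofNat (algebraMap (ZMod 2) (Rb n c)) 2, show (OfNat.ofNat 2 : ZMod 2) = 0 from rfl,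
    map_zero]

lemma x_pow_two_mul_add_two (n : ℕ) (c : ZMod 2) : x n c ^ (2 * n + 2) = 0 := by
  rw [x, ← map_pow]
  exact Ideal.Quotient.eq_zero_iff_mem.mpr (Ideal.subset_span (Set.mem_insert _ _))

lemma v_sq_relation (n : ℕ) (c : ZMod 2) :
    v n c ^ 2 + algebraMap (ZMod 2) (Rb n c) c
      + algebraMap (ZMod 2) (Rb n c) ((n : ZMod 2) + 1) * x n c ^ (2 * n) * w n c = 0 := by
  have h : mkRb n c ((X 1 : P) ^ 2 + C c + C ((n : ZMod 2) + 1) * (X 0 : P) ^ (2 * n) * X 2) = 0 :=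
    Ideal.Quotient.eq_zero_iff_mem.mpr
      (Ideal.subset_span (Set.mem_insert_of_mem _ (Set.mem_singleton _)))
  simpa only [← MvPolynomial.algebraMap_eq, map_add, map_mul, map_pow, AlgHom.commutes, x, v, w]
    using h

lemma x_pow_two_mul_sq (n : ℕ) (hn : 1 ≤ n) (c : ZMod 2) : (x n c ^ (2 * n)) ^ 2 = 0 := by
  rw [← pow_mul]
  exact pow_eq_zero_of_le (by omega) (x_pow_two_mul_add_two n c)

lemma algHom_ext_Rb {n : ℕ} {b : ZMod 2} {A : Type*} [Semiring A] [Algebra (ZMod 2) A]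
    {f g : Rb n b →ₐ[ZMod 2] A} (hx : f (x n b) = g (x n b)) (hv : f (v n b) = g (v n b))
    (hw : f (w n b) = g (w n b)) : f = g := by
  refine Ideal.Quotient.algHom_ext _ (MvPolynomial.algHom_ext fun i => ?_)
  fin_cases i
  exacts [hx, hv, hw]

/-- The image `v + (b + c) + a x^{2n} w + d x^{2n} v w` in `R_c` of the generator `v` of `R_b`
under a change of variables. -/
def shiftedV (n : ℕ) (b c a d : ZMod 2) : Rb n c :=
  v n c + algebraMap (ZMod 2) (Rb n c) (b + c)
    + algebraMap (ZMod 2) (Rb n c) a * (x n c ^ (2 * n) * w n c)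
    + algebraMap (ZMod 2) (Rb n c) d * (x n c ^ (2 * n) * v n c * w n c)

lemma shiftedV_sq_relation (n : ℕ) (hn : 1 ≤ n) (b c a d : ZMod 2) :
    shiftedV n b c a d ^ 2 + algebraMap (ZMod 2) (Rb n c) b
      + algebraMap (ZMod 2) (Rb n c) ((n : ZMod 2) + 1) * x n c ^ (2 * n) * w n c = 0 := by
  have h2 := two_eq_zero_Rb n c
  have hx := x_pow_two_mul_sq n hn c
  have hv := v_sq_relation n c
  have hbc : algebraMap (ZMod 2) (Rb n c) (b + c) ^ 2
      = algebraMap (ZMod 2) (Rb n c) b + algebraMap (ZMod 2) (Rb n c) c := by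
    rw [← map_pow, ZMod.pow_card, map_add]
  have hsq : ∀ r s : Rb n c, (r + s) ^ 2 = r ^ 2 + s ^ 2 := fun r s => by
    linear_combination r * s * h2
  rw [shiftedV, hsq, hsq, hsq, hbc]
  simp only [mul_pow, hx]
  linear_combination hv + algebraMap (ZMod 2) (Rb n c) b * h2

/-- The `ℤ/2`-algebra homomorphism `R_b → R_c` with `x ↦ x`, `w ↦ w` and
`v ↦ v + (b + c) + a x^{2n} w + d x^{2n} v w`. -/
def shiftHom (n : ℕ) (hn : 1 ≤ n) (b c a d : ZMod 2) : Rb n b →ₐ[ZMod 2] Rb n c :=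
  Ideal.Quotient.liftₐ (relIdealB n b)
    (MvPolynomial.aeval ![x n c, shiftedV n b c a d, w n c]) (by
      intro p hp
      refine (Ideal.span_le (I := RingHom.ker
        (MvPolynomial.aeval (R := ZMod 2) ![x n c, shiftedV n b c a d, w n c]))).mpr ?_ hp
      rintro q (rfl | rfl)
      · simpa [RingHom.mem_ker] using x_pow_two_mul_add_two n c
      · simpa [RingHom.mem_ker, MvPolynomial.aeval_C] using shiftedV_sq_relation n hn b c a d)

section

variable (n : ℕ) (hn : 1 ≤ n) (b c a d : ZMod 2)

lemma shiftHom_x : shiftHom n hn b c a d (x n b) = x n c :=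
  MvPolynomial.aeval_X _ _

lemma shiftHom_v : shiftHom n hn b c a d (v n b) = shiftedV n b c a d :=
  MvPolynomial.aeval_X _ _

lemma shiftHom_w : shiftHom n hn b c a d (w n b) = w n c :=
  MvPolynomial.aeval_X _ _

lemma shiftHom_comp_shiftHom {a' : ZMod 2} (ha : a' = a + d * (b + c)) :
    (shiftHom n hn c b a' d).comp (shiftHom n hn b c a d) = AlgHom.id (ZMod 2) (Rb n b) := by
  have h2 := two_eq_zero_Rb n b
  have hx := x_pow_two_mul_sq n hn b
  refine algHom_ext_Rb ?_ ?_ ?_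
  · simp [shiftHom_x]
  · simp only [AlgHom.comp_apply, AlgHom.id_apply, shiftHom_v]
    rw [shiftedV]
    simp only [map_add, map_mul, map_pow, AlgHom.commutes, shiftHom_x, shiftHom_v, shiftHom_w]
    rw [shiftedV, ha]
    simp only [map_add, map_mul]
    generalize x n b ^ (2 * n) = y at *
    generalize algebraMap (ZMod 2) (Rb n b) a = a
    generalize algebraMap (ZMod 2) (Rb n b) b = s
    generalize algebraMap (ZMod 2) (Rb n b) c = t
    generalize algebraMap (ZMod 2) (Rb n b) d = d
    generalize v n b = v
    generalize w n b = w
    linear_combination (s + t + a * y * w + d * y * v * w + d * (s + t) * y * w) * h2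
      + (d * w * ((a + d * (s + t)) * w + d * v * w)) * hx
  · simp [shiftHom_w]

end

/-- For `ṽ = v + b₁ + b₂ x^{2n} w + b₃ x^{2n} v w` in `R = R₀`, the `ℤ/2`-algebra
homomorphism from `(ℤ/2)[X,V,W]/(X^{2n+2}, V² + b₁ + (n+1)X^{2n}W)` to `R` determined by
`X ↦ x`, `V ↦ ṽ`, `W ↦ w` is well defined and an isomorphism. -/
theorem stmt_8 (n : ℕ) (hn : 1 ≤ n) (b₁ b₂ b₃ : ZMod 2) (vt : Rb n 0)
    (hvt : vt = v n 0 + b₁ • (1 : Rb n 0) + b₂ • (x n 0 ^ (2 * n) * w n 0)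
      + b₃ • (x n 0 ^ (2 * n) * v n 0 * w n 0)) :
    ∃ e : Rb n b₁ ≃ₐ[ZMod 2] Rb n 0,
      e (x n b₁) = x n 0 ∧ e (v n b₁) = vt ∧ e (w n b₁) = w n 0 := by
  refine ⟨AlgEquiv.ofAlgHom (shiftHom n hn b₁ 0 b₂ b₃) (shiftHom n hn 0 b₁ (b₂ + b₃ * b₁) b₃)
    (shiftHom_comp_shiftHom _ _ _ _ _ _ ?_) (shiftHom_comp_shiftHom _ _ _ _ _ _ ?_), ?_, ?_, ?_⟩
  · rw [zero_add, add_assoc, CharTwo.add_self_eq_zero, add_zero]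
  · ring
  · exact shiftHom_x n hn b₁ 0 b₂ b₃
  · have smul_eq (r : ZMod 2) (y : Rb n 0) : r • y = algebraMap (ZMod 2) (Rb n 0) r * y :=
      Algebra.smul_def r y
    rw [hvt]
    refine (shiftHom_v n hn b₁ 0 b₂ b₃).trans ?_
    simp only [shiftedV, smul_eq, add_zero, mul_one]
  · exact shiftHom_w n hn b₁ 0 b₂ b₃

end
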